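/- For every λ ∈ ℂ \ {0} and every finitely supported sequence (r^{(i)})_{i≥0} of complex numbers, the linear operators L_m, W_m (m ∈ ℤ) on ℂ[s,t] defining Θ(λ,r) satisfy L_m∘L_n − L_n∘L_m = (n−m)L_{m+n}, L_m∘W_n − W_n∘L_m = (n+m)W_{m+n}, and W_m∘W_n − W_n∘W_m = 0 for all m, n ∈ ℤ; hence Θ(λ,r) is a module over the Lie algebra W(0,1). -/

import Mathlib

open MvPolynomial

noncomputable section

/-- The polynomial ring `ℂ[s,t]`, realized as `MvPolynomial (Fin 2) ℂ`
with `s = X 0` and `t = X 1`. -/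
abbrev R2 : Type := MvPolynomial (Fin 2) ℂ

/-- The substitution `f(s,t) ↦ f(s-m,t)`, as a `ℂ`-linear map on `ℂ[s,t]`. -/
def shiftS (m : ℤ) : R2 →ₗ[ℂ] R2 :=
  (aeval (fun i : Fin 2 => if i = 0 then (X 0 - C (m : ℂ) : R2) else (X 1 : R2))).toLinearMap

/-- Multiplication by a fixed polynomial, as a `ℂ`-linear map. -/
def mulBy (p : R2) : R2 →ₗ[ℂ] R2 := LinearMap.mulLeft ℂ p

/-- The partial derivative `∂/∂t`, as a `ℂ`-linear map. -/
def dT : R2 →ₗ[ℂ] R2 := (pderiv (1 : Fin 2)).toLinearMap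

/-- Kronecker delta on `ℂ`. -/
def dlt (x y : ℂ) : ℂ := if x = y then 1 else 0

/-- `q_{n,k;α}(t) = n t^k − δ_{b,−1} n(n−1)α Σ_{j=0}^{k−1} α^{k−1−j} t^j
− δ_{b,1} n α Σ_{j=0}^{k−1} α^{k−1−j} t^j`. -/
def qpoly (b α : ℂ) (n : ℤ) (k : ℕ) : R2 :=
  (n : ℂ) • ((X 1 : R2) ^ k)
    - (dlt b (-1) * (n : ℂ) * ((n : ℂ) - 1) * α) •
        ∑ j ∈ Finset.range k, (C (α ^ (k - 1 - j)) * (X 1 : R2) ^ j)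
    - (dlt b 1 * (n : ℂ) * α) •
        ∑ j ∈ Finset.range k, (C (α ^ (k - 1 - j)) * (X 1 : R2) ^ j)

/-- `h_n(t) = Σ_i h^{(i)} q_{n,i;α}(t)` for a finitely supported sequence `h`. -/
def hpol (b α : ℂ) (h : ℕ →₀ ℂ) (n : ℤ) : R2 := h.sum fun i c => c • qpoly b α n i

/-- The polynomial `t − δ_{b,−1} mα − δ_{b,1}(1−δ_{m,0})α`. -/
def wcoef (b α : ℂ) (m : ℤ) : R2 :=
  X 1 - C (dlt b (-1) * (m : ℂ) * α + dlt b 1 * (if m = 0 then 0 else 1) * α)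

/-- The operator `W_m` of the module `Φ(λ,α,h)`:
`W_m · f(s,t) = λ^m (t − δ_{b,−1} mα − δ_{b,1}(1−δ_{m,0})α) f(s−m,t)`. -/
def PhiW (b lam α : ℂ) (m : ℤ) : R2 →ₗ[ℂ] R2 :=
  mulBy (C (lam ^ m) * wcoef b α m) ∘ₗ shiftS m

/-- The operator `L_m` of the module `Φ(λ,α,h)`:
`L_m · f(s,t) = λ^m (s + h_m(t)) f(s−m,t)
 + b m λ^m (t − δ_{b,−1} mα − δ_{b,1}(1−δ_{m,0})α) (∂f/∂t)(s−m,t)`. -/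
def PhiL (b lam α : ℂ) (h : ℕ →₀ ℂ) (m : ℤ) : R2 →ₗ[ℂ] R2 :=
  mulBy (C (lam ^ m) * (X 0 + hpol b α h m)) ∘ₗ shiftS m
    + (b * (m : ℂ) * lam ^ m) • (mulBy (wcoef b α m) ∘ₗ (shiftS m ∘ₗ dT))

/-- `r_m(t) = Σ_i r^{(i)} m t^i` for a finitely supported sequence `r`. -/
def rpol (r : ℕ →₀ ℂ) (m : ℤ) : R2 := r.sum fun i c => (c * (m : ℂ)) • ((X 1 : R2) ^ i)

/-- The operator `L_m` of the module `Θ(λ,r)`: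
`L_m · f(s,t) = λ^m (s + r_m(t)) f(s−m,t)`. -/
def ThetaL (lam : ℂ) (r : ℕ →₀ ℂ) (m : ℤ) : R2 →ₗ[ℂ] R2 :=
  mulBy (C (lam ^ m) * (X 0 + rpol r m)) ∘ₗ shiftS m

/-- The operator `W_m` of the module `Θ(λ,r)`: `W_m · f(s,t) = δ_{m,0} t f(s,t)`. -/
def ThetaW (m : ℤ) : R2 →ₗ[ℂ] R2 := if m = 0 then mulBy (X 1) else 0

theorem rpol_eq (r : ℕ →₀ ℂ) (m : ℤ) : rpol r m = C (m : ℂ) * rpol r 1 := by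
  simp only [rpol, Finsupp.sum, Finset.mul_sum]
  refine Finset.sum_congr rfl fun i _ => ?_
  simp only [smul_eq_C_mul, C_mul, Int.cast_one, mul_one]
  ring

theorem shiftS_mul (m : ℤ) (p q : R2) : shiftS m (p * q) = shiftS m p * shiftS m q := by
  simp [shiftS]

theorem shiftS_C (m : ℤ) (c : ℂ) : shiftS m (C c) = C c := by
  simp [shiftS, algebraMap_eq]

theorem shiftS_X_zero (m : ℤ) : shiftS m (X 0) = X 0 - C (m : ℂ) := by
  simp [shiftS]

theorem shiftS_X_one (m : ℤ) : shiftS m (X 1) = X 1 := by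
  simp [shiftS]

theorem shiftS_rpol (m n : ℤ) (r : ℕ →₀ ℂ) : shiftS m (rpol r n) = rpol r n := by
  simp [shiftS, rpol, Finsupp.sum]

theorem shiftS_shiftS (m n : ℤ) (f : R2) : shiftS m (shiftS n f) = shiftS (m + n) f := by
  induction f using MvPolynomial.induction_on with
  | C a => simp only [shiftS_C]
  | add p q hp hq => simp only [map_add, hp, hq]
  | mul_X p i hp =>
    simp only [shiftS_mul, hp]
    fin_cases i
    · simp only [Fin.zero_eta, shiftS_X_zero, map_sub, shiftS_C, Int.cast_add, C_add]
      ring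
    · simp only [Fin.mk_one, shiftS_X_one]

theorem ThetaL_apply (lam : ℂ) (r : ℕ →₀ ℂ) (m : ℤ) (f : R2) :
    ThetaL lam r m f = C (lam ^ m) * (X 0 + C (m : ℂ) * rpol r 1) * shiftS m f := by
  rw [← rpol_eq]
  rfl

theorem ThetaL_ThetaL_apply (lam : ℂ) (hlam : lam ≠ 0) (r : ℕ →₀ ℂ) (m n : ℤ) (f : R2) :
    ThetaL lam r m (ThetaL lam r n f) =
      C (lam ^ (m + n)) * ((X 0 + C (m : ℂ) * rpol r 1) *
        (X 0 - C (m : ℂ) + C (n : ℂ) * rpol r 1)) * shiftS (m + n) f := by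
  simp only [ThetaL_apply, shiftS_mul, map_add, shiftS_C, shiftS_X_zero, shiftS_rpol,
    shiftS_shiftS, zpow_add₀ hlam, C_mul]
  ring

theorem ThetaL_mul_X_one (lam : ℂ) (r : ℕ →₀ ℂ) (m : ℤ) (f : R2) :
    ThetaL lam r m (X 1 * f) = X 1 * ThetaL lam r m f := by
  simp only [ThetaL_apply, shiftS_mul, shiftS_X_one]
  ring

theorem ThetaW_zero : ThetaW 0 = mulBy (X 1) := if_pos rfl

theorem ThetaW_of_ne_zero {m : ℤ} (hm : m ≠ 0) : ThetaW m = 0 := if_neg hm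

theorem intCast_smul_ThetaW (m : ℤ) : (m : ℂ) • ThetaW m = 0 := by
  rcases eq_or_ne m 0 with rfl | hm
  · simp
  · rw [ThetaW_of_ne_zero hm, smul_zero]

/-- the operators defining `Θ(λ,r)` satisfy the defining relations of the
Lie algebra `W(0,1)`, so `Θ(λ,r)` is a `W(0,1)`-module. -/
theorem stmt3 (lam : ℂ) (hlam : lam ≠ 0) (r : ℕ →₀ ℂ) :
    (∀ m n : ℤ,
      ThetaL lam r m ∘ₗ ThetaL lam r n - ThetaL lam r n ∘ₗ ThetaL lam r m
        = ((n : ℂ) - (m : ℂ)) • ThetaL lam r (m + n)) ∧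
    (∀ m n : ℤ,
      ThetaL lam r m ∘ₗ ThetaW n - ThetaW n ∘ₗ ThetaL lam r m
        = ((n : ℂ) + (m : ℂ)) • ThetaW (m + n)) ∧
    (∀ m n : ℤ, ThetaW m ∘ₗ ThetaW n - ThetaW n ∘ₗ ThetaW m = 0) := by
  refine ⟨fun m n => LinearMap.ext fun f => ?_, fun m n => ?_, fun m n => ?_⟩
  · simp only [LinearMap.sub_apply, LinearMap.comp_apply, LinearMap.smul_apply,
      ThetaL_ThetaL_apply lam hlam, add_comm n m]
    simp only [ThetaL_apply, smul_eq_C_mul, C_sub, C_add, Int.cast_add]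
    ring
  · rw [← Int.cast_add, add_comm n m, intCast_smul_ThetaW, sub_eq_zero]
    rcases eq_or_ne n 0 with rfl | hn
    · rw [ThetaW_zero]
      exact LinearMap.ext fun f => ThetaL_mul_X_one lam r m f
    · rw [ThetaW_of_ne_zero hn, LinearMap.comp_zero, LinearMap.zero_comp]
  · rcases eq_or_ne m 0 with rfl | hm
    · rcases eq_or_ne n 0 with rfl | hn
      · exact sub_self _
      · simp [ThetaW_of_ne_zero hn]
    · simp [ThetaW_of_ne_zero hm]
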